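/- Let β ∈ (0,1) be irrational with continued fraction expansion β = [0; d_1, d_2, …], convergents p_k/q_k, and let G be the Gauss map. Suppose (k_i)_{i∈ℕ} is a strictly increasing sequence of positive integers such that q_{k_i−1}/q_{k_i} → w and G^{k_i}(β) → θ as i → ∞, where θ ∈ (0,1) and 1/θ is not an integer. Then (p_{k_i+1} + q_{k_i+1} + p_{k_i} + q_{k_i}) · (1/(β+1)) · |β·q_{k_i} − p_{k_i}| → (1 + ⌊1/θ⌋ + w)·θ / (1 + θ·w) as i → ∞. -/

import Mathlib

open Function

/-- The Gauss map `G(t) = 1/t − ⌊1/t⌋`, the fractional part of `1/t`. -/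
noncomputable def gaussMap (t : ℝ) : ℝ := Int.fract (1 / t)

/-- `cfP β k` is the continued fraction numerator `p_{k-1}` of `β`:
`p_{-1} = 1`, `p_0 = 0`, `p_k = d_k p_{k-1} + p_{k-2}` where `d_k = ⌊1/G^{k-1}(β)⌋`
are the partial quotients of `β = [0; d_1, d_2, …]`. -/
noncomputable def cfP (β : ℝ) : ℕ → ℝ
  | 0 => 1
  | 1 => 0
  | (k + 2) => (⌊1 / (gaussMap^[k] β)⌋₊ : ℝ) * cfP β (k + 1) + cfP β k

/-- `cfQ β k` is the continued fraction denominator `q_{k-1}` of `β`: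
`q_{-1} = 0`, `q_0 = 1`, `q_k = d_k q_{k-1} + q_{k-2}` where `d_k = ⌊1/G^{k-1}(β)⌋`
are the partial quotients of `β = [0; d_1, d_2, …]`. -/
noncomputable def cfQ (β : ℝ) : ℕ → ℝ
  | 0 => 0
  | 1 => 1
  | (k + 2) => (⌊1 / (gaussMap^[k] β)⌋₊ : ℝ) * cfQ β (k + 1) + cfQ β k


open Filter Topology

theorem gaussMap_iterate_irrational {β : ℝ} (hirr : Irrational β) (n : ℕ) :
    Irrational (gaussMap^[n] β) := by
  induction n with
  | zero => exact hirr
  | succ n ih =>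
    rw [Function.iterate_succ_apply', gaussMap, one_div]
    exact ih.inv.sub_intCast _

theorem gaussMap_iterate_mem {β : ℝ} (hirr : Irrational β) (h0 : 0 < β) (h1 : β < 1) (n : ℕ) :
    0 < gaussMap^[n] β ∧ gaussMap^[n] β < 1 := by
  cases n with
  | zero => exact ⟨h0, h1⟩
  | succ n =>
    have h := gaussMap_iterate_irrational hirr (n + 1)
    rw [Function.iterate_succ_apply', gaussMap] at h ⊢
    exact ⟨lt_of_le_of_ne (Int.fract_nonneg _) h.ne_zero.symm, Int.fract_lt_one _⟩

theorem one_div_eq_floor_add_gaussMap {t : ℝ} (ht : 0 < t) :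
    1 / t = (⌊1 / t⌋₊ : ℝ) + gaussMap t := by
  rw [gaussMap, natCast_floor_eq_intCast_floor (by positivity), Int.floor_add_fract]

theorem one_le_floor_one_div {t : ℝ} (h0 : 0 < t) (h1 : t < 1) : (1 : ℝ) ≤ (⌊1 / t⌋₊ : ℝ) := by
  exact_mod_cast Nat.le_floor (by rw [Nat.cast_one, le_div_iff₀ h0]; linarith)

theorem abs_cfP_mul_cfQ_sub (β : ℝ) (n : ℕ) :
    |cfP β n * cfQ β (n + 1) - cfP β (n + 1) * cfQ β n| = 1 := by
  induction n with
  | zero => simp [cfP, cfQ]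
  | succ n ih =>
    rw [← ih, ← abs_neg]
    congr 1
    simp only [cfP, cfQ]
    ring

theorem cfQ_nonneg (β : ℝ) (n : ℕ) : 0 ≤ cfQ β n ∧ 0 ≤ cfQ β (n + 1) := by
  induction n with
  | zero => simp [cfQ]
  | succ n ih =>
    refine ⟨ih.2, ?_⟩
    rw [cfQ]
    exact add_nonneg (mul_nonneg (Nat.cast_nonneg _) ih.2) ih.1

theorem one_le_cfQ_succ {β : ℝ} (hirr : Irrational β) (h0 : 0 < β) (h1 : β < 1) (n : ℕ) :
    1 ≤ cfQ β (n + 1) := by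
  induction n with
  | zero => simp [cfQ]
  | succ n ih =>
    obtain ⟨hg0, hg1⟩ := gaussMap_iterate_mem hirr h0 h1 n
    have hd := one_le_floor_one_div hg0 hg1
    have hq := (cfQ_nonneg β n).1
    rw [cfQ]
    nlinarith

theorem le_cfQ_succ {β : ℝ} (hirr : Irrational β) (h0 : 0 < β) (h1 : β < 1) (n : ℕ) :
    (n : ℝ) ≤ cfQ β (n + 1) := by
  induction n with
  | zero => simp [cfQ]
  | succ n ih =>
    cases n with
    | zero => simpa using one_le_cfQ_succ hirr h0 h1 1
    | succ n =>
      obtain ⟨hg0, hg1⟩ := gaussMap_iterate_mem hirr h0 h1 (n + 1)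
      have hd := one_le_floor_one_div hg0 hg1
      have hq := one_le_cfQ_succ hirr h0 h1 n
      have hq' := one_le_cfQ_succ hirr h0 h1 (n + 1)
      rw [cfQ]
      push_cast at ih ⊢
      nlinarith

theorem mul_cfQ_add_eq {β : ℝ} (hirr : Irrational β) (h0 : 0 < β) (h1 : β < 1) (n : ℕ) :
    β * (cfQ β (n + 1) + gaussMap^[n] β * cfQ β n) =
      cfP β (n + 1) + gaussMap^[n] β * cfP β n := by
  induction n with
  | zero => simp [cfP, cfQ]
  | succ n ih =>
    have hg0 := (gaussMap_iterate_mem hirr h0 h1 n).1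
    have h := one_div_eq_floor_add_gaussMap hg0
    rw [Function.iterate_succ_apply', cfP, cfQ]
    set g := gaussMap^[n] β
    have hg : gaussMap g = 1 / g - (⌊1 / g⌋₊ : ℝ) := by linarith
    rw [hg]
    field_simp
    linear_combination ih

/-- The approximation error of a convergent, in terms of the Gauss orbit. -/
theorem abs_mul_cfQ_sub_cfP {β : ℝ} (hirr : Irrational β) (h0 : 0 < β) (h1 : β < 1) (n : ℕ) :
    |β * cfQ β (n + 1) - cfP β (n + 1)| =
      gaussMap^[n] β / (cfQ β (n + 1) + gaussMap^[n] β * cfQ β n) := by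
  have hg0 := (gaussMap_iterate_mem hirr h0 h1 n).1
  have hq := (cfQ_nonneg β n).1
  have hq' := one_le_cfQ_succ hirr h0 h1 n
  have h := mul_cfQ_add_eq hirr h0 h1 n
  have hpos : 0 < cfQ β (n + 1) + gaussMap^[n] β * cfQ β n := by positivity
  rw [eq_div_iff hpos.ne', ← abs_of_pos hpos, ← abs_mul]
  have : (β * cfQ β (n + 1) - cfP β (n + 1)) * (cfQ β (n + 1) + gaussMap^[n] β * cfQ β n) =
      gaussMap^[n] β * (cfP β n * cfQ β (n + 1) - cfP β (n + 1) * cfQ β n) := by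
    linear_combination cfQ β (n + 1) * h
  rw [this, abs_mul, abs_cfP_mul_cfQ_sub, mul_one, abs_of_pos hg0]

theorem tendsto_mul_cfQ_sub_cfP {β : ℝ} (hirr : Irrational β) (h0 : 0 < β) (h1 : β < 1) :
    Tendsto (fun n => β * cfQ β (n + 1) - cfP β (n + 1)) atTop (𝓝 0) := by
  have hinv : Tendsto (fun n => (cfQ β (n + 1))⁻¹) atTop (𝓝 0) :=
    (tendsto_atTop_mono (le_cfQ_succ hirr h0 h1) tendsto_natCast_atTop_atTop).inv_tendsto_atTop
  refine squeeze_zero_norm (fun n => ?_) hinv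
  obtain ⟨hg0, hg1⟩ := gaussMap_iterate_mem hirr h0 h1 n
  have hq := (cfQ_nonneg β n).1
  have hq' := one_le_cfQ_succ hirr h0 h1 n
  rw [Real.norm_eq_abs, abs_mul_cfQ_sub_cfP hirr h0 h1, inv_eq_one_div]
  have : 0 ≤ gaussMap^[n] β * cfQ β n := by positivity
  gcongr
  linarith

theorem eventually_floor_eq_of_tendsto {ι : Type*} {l : Filter ι} {f : ι → ℝ} {a : ℝ}
    (ha : 0 ≤ a) (hna : ¬ ∃ m : ℤ, a = m) (hf : Tendsto f l (𝓝 a)) :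
    ∀ᶠ i in l, ⌊f i⌋₊ = ⌊a⌋₊ := by
  have hlt : (⌊a⌋₊ : ℝ) < a :=
    lt_of_le_of_ne (Nat.floor_le ha) fun h => hna ⟨(⌊a⌋₊ : ℤ), by simpa using h.symm⟩
  filter_upwards [hf.eventually_const_lt hlt, hf.eventually_lt_const (Nat.lt_floor_add_one a)]
    with i h₁ h₂
  exact (Nat.floor_eq_iff ((Nat.cast_nonneg _).trans h₁.le)).2 ⟨h₁.le, h₂⟩

/-- For irrational `β ∈ (0,1)` with convergents `p_k/q_k`, Gauss map `G`,
and a strictly increasing sequence `(k_i)` of positive integers with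
`q_{k_i−1}/q_{k_i} → w` and `G^{k_i}(β) → θ ∈ (0,1)` where `1/θ` is not an integer,
one has `(p_{k_i+1} + q_{k_i+1} + p_{k_i} + q_{k_i})·(1/(β+1))·|β·q_{k_i} − p_{k_i}| →
(1 + ⌊1/θ⌋ + w)·θ/(1 + θ·w)`. -/
theorem stmt_17 (β : ℝ) (hirr : Irrational β) (h0 : 0 < β) (h1 : β < 1)
    (k : ℕ → ℕ) (hk : StrictMono k) (hk1 : ∀ i, 1 ≤ k i)
    (w θ : ℝ) (hθ0 : 0 < θ) (hθ1 : θ < 1)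
    (hθint : ¬ ∃ m : ℤ, 1 / θ = (m : ℝ))
    (hw : Filter.Tendsto (fun i => cfQ β (k i) / cfQ β (k i + 1)) Filter.atTop (nhds w))
    (hθ : Filter.Tendsto (fun i => gaussMap^[k i] β) Filter.atTop (nhds θ)) :
    Filter.Tendsto
      (fun i => (cfP β (k i + 2) + cfQ β (k i + 2) + cfP β (k i + 1) + cfQ β (k i + 1)) *
        (1 / (β + 1)) * |β * cfQ β (k i + 1) - cfP β (k i + 1)|)
      Filter.atTop (nhds ((1 + (⌊1 / θ⌋₊ : ℝ) + w) * θ / (1 + θ * w))) := by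
  have hkt := hk.tendsto_atTop
  have hD := tendsto_mul_cfQ_sub_cfP hirr h0 h1
  have hD1 := hD.comp hkt
  have hD2 := hD.comp ((tendsto_add_atTop_nat 1).comp hkt)
  have hw0 : 0 ≤ w := ge_of_tendsto' hw fun i =>
    div_nonneg (cfQ_nonneg β (k i)).1 (cfQ_nonneg β (k i)).2
  have hfloor := eventually_floor_eq_of_tendsto (by positivity) hθint
    (tendsto_const_nhds.div hθ hθ0.ne')
  have herr := ((hD2.add hD1).mul hD1.abs).mul_const (1 / (β + 1))
  have hmain := (((hw.const_add (1 + (⌊1 / θ⌋₊ : ℝ))).mul hθ).div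
    ((hθ.mul hw).const_add 1) (by positivity)).sub herr
  simp only [abs_zero, add_zero, mul_zero, zero_mul, sub_zero] at hmain
  refine hmain.congr' ?_
  filter_upwards [hfloor] with i hi
  obtain ⟨hg0, -⟩ := gaussMap_iterate_mem hirr h0 h1 (k i)
  have hq := (cfQ_nonneg β (k i)).1
  have hq' := one_le_cfQ_succ hirr h0 h1 (k i)
  have hQ : cfQ β (k i + 2) = (⌊1 / θ⌋₊ : ℝ) * cfQ β (k i + 1) + cfQ β (k i) := by
    rw [cfQ, ← hi, Pi.div_apply]
  have hratio : (1 + (⌊1 / θ⌋₊ : ℝ) + cfQ β (k i) / cfQ β (k i + 1)) * gaussMap^[k i] β /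
      (1 + gaussMap^[k i] β * (cfQ β (k i) / cfQ β (k i + 1))) =
      (cfQ β (k i + 2) + cfQ β (k i + 1)) * |β * cfQ β (k i + 1) - cfP β (k i + 1)| := by
    rw [abs_mul_cfQ_sub_cfP hirr h0 h1, hQ]
    have : 0 < cfQ β (k i + 1) := by linarith
    field_simp
    ring
  simp only [Pi.div_apply, Function.comp_apply]
  rw [hratio]
  have : β + 1 ≠ 0 := by positivity
  field_simp
  ring
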